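/- For all real t, the integral over (0,∞) of (cos(tx) − 1)·(π/4)·csch²(πx/2)·[2π²x²·coth²(πx/2) + π²x²·csch²(πx/2) − 6πx·coth(πx/2) + 2] dx equals 3t²·csch²(t) − t·coth(t)·(2t²·csch²(t) + 1) (interpreted as its limit 0 at t = 0). -/

import Mathlib

open Real MeasureTheory

lemma aux_moment (n : ℕ) {a : ℝ} (ha : 0 < a) :
    IntegrableOn (fun x : ℝ => x ^ n * Real.exp (-(a * x))) (Set.Ioi 0) ∧
    ∫ x in Set.Ioi (0:ℝ), x ^ n * Real.exp (-(a * x)) = n.factorial / a ^ (n + 1) := by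
  constructor
  · have h := integrableOn_rpow_mul_exp_neg_mul_rpow (p := 1) (s := n) (b := a)
      (by have : (0:ℝ) ≤ n := n.cast_nonneg
          linarith) one_pos ha
    refine h.congr_fun (fun x hx => ?_) measurableSet_Ioi
    simp
  · have h := Real.integral_rpow_mul_exp_neg_mul_Ioi (a := (n:ℝ) + 1) (r := a) (by positivity) ha
    simp only [add_sub_cancel_right, Real.rpow_natCast] at h
    rw [h, Real.Gamma_nat_eq_factorial]
    rw [show ((n:ℝ)+1) = ((n+1 : ℕ):ℝ) by push_cast; ring, Real.rpow_natCast, one_div, inv_pow]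
    field_simp

lemma aux_complex {a t : ℝ} (ha : 0 < a) :
    IntegrableOn (fun x : ℝ => (1 - 3 * a * x + a ^ 2 * x ^ 2 : ℂ) *
      Complex.exp (-((a - t * Complex.I) * x))) (Set.Ioi 0) ∧
    ∫ x in Set.Ioi (0:ℝ), (1 - 3 * a * x + a ^ 2 * x ^ 2 : ℂ) *
      Complex.exp (-((a - t * Complex.I) * x)) =
      (1 / (a - t * Complex.I) - 3 * a / (a - t * Complex.I) ^ 2
        + 2 * a ^ 2 / (a - t * Complex.I) ^ 3 : ℂ) := by
  set z : ℂ := a - t * Complex.I with hz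
  have hzre : z.re = a := by simp [hz]
  have hz0 : z ≠ 0 := by
    intro h; rw [h] at hzre; simp at hzre; linarith
  have hnorm : ∀ x : ℝ, ‖Complex.exp (-(z * x))‖ = Real.exp (-(a * x)) := by
    intro x
    rw [Complex.norm_exp]; simp [hzre]
  have hint : ∀ n : ℕ, IntegrableOn (fun x : ℝ => (x:ℂ) ^ n * Complex.exp (-(z * x)))
      (Set.Ioi 0) := by
    intro n
    refine Integrable.mono' (aux_moment n ha).1 (by fun_prop) ?_
    filter_upwards [ae_restrict_mem measurableSet_Ioi] with x hx
    rw [norm_mul, hnorm, norm_pow, Complex.norm_real, Real.norm_of_nonneg (le_of_lt hx)]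
  have hI : IntegrableOn (fun x : ℝ => (1 - 3 * a * x + a ^ 2 * x ^ 2 : ℂ) *
      Complex.exp (-(z * x))) (Set.Ioi 0) := by
    have := (((hint 0).const_mul (1:ℂ)).add ((hint 1).const_mul (-3 * a : ℂ))).add
      ((hint 2).const_mul (a ^ 2 : ℂ))
    refine this.congr (Filter.Eventually.of_forall fun x => ?_)
    simp; ring
  refine ⟨hI, ?_⟩
  set c2 : ℂ := -a ^ 2 / z with hc2
  set c1 : ℂ := (2 * c2 + 3 * a) / z with hc1
  set c0 : ℂ := (c1 - 1) / z with hc0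
  have hlim : ∀ n : ℕ, Filter.Tendsto (fun x : ℝ => (x:ℂ) ^ n * Complex.exp (-(z * x)))
      Filter.atTop (nhds 0) := by
    intro n
    rw [tendsto_zero_iff_norm_tendsto_zero]
    have h := Real.tendsto_pow_mul_exp_neg_atTop_nhds_zero n
    have h2 := tendsto_rpow_mul_exp_neg_mul_atTop_nhds_zero (n:ℝ) a ha
    refine h2.congr' ?_
    filter_upwards [Filter.eventually_gt_atTop 0] with x hx
    rw [norm_mul, hnorm, norm_pow, Complex.norm_real, Real.norm_of_nonneg (le_of_lt hx),
      Real.rpow_natCast]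
    simp
  have key := integral_Ioi_of_hasDerivAt_of_tendsto' (a := (0:ℝ)) (m := (0:ℂ))
    (f := fun x : ℝ => (c0 + c1 * x + c2 * x ^ 2) * Complex.exp (-(z * x)))
    (f' := fun x : ℝ => (1 - 3 * a * x + a ^ 2 * x ^ 2 : ℂ) *
      Complex.exp (-(z * x))) ?_ hI ?_
  · rw [key, hc0, hc1, hc2]
    simp
    field_simp
    ring
  · intro x _
    have hx : HasDerivAt (fun x : ℝ => (x:ℂ)) 1 x := Complex.ofRealCLM.hasDerivAt
    have h1 := ((hx.const_mul c1).const_add c0).add ((hx.pow 2).const_mul c2)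
    have h2 := (hx.const_mul z).neg.cexp
    refine (h1.mul h2).congr_deriv ?_
    have e2 : c2 * z = - a ^ 2 := by rw [hc2]; field_simp
    have e1 : c1 * z = 2 * c2 + 3 * a := by rw [hc1]; field_simp
    have e0 : c0 * z = c1 - 1 := by rw [hc0]; field_simp
    simp only [Pi.add_apply, Pi.neg_apply, Pi.pow_apply]
    push_cast
    linear_combination (-Complex.exp (-(z * x))) * (e0 + x * e1 + x ^ 2 * e2)
  · have := (((hlim 0).const_mul c0).add ((hlim 1).const_mul c1)).add ((hlim 2).const_mul c2)
    simp only [mul_zero, add_zero] at this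
    refine this.congr fun x => ?_
    ring

noncomputable def auxF (t a x : ℝ) : ℝ :=
  (Real.cos (t * x) - 1) * (2 * a * (1 - 3 * a * x + a ^ 2 * x ^ 2) * Real.exp (-(a * x)))

lemma aux_re (a t q : ℝ) : RCLike.re ((2 * a : ℂ) * ((a + t * Complex.I) * (q : ℂ)
      - 3 * a * ((a + t * Complex.I) * (q:ℂ)) ^ 2
       + 2 * a ^ 2 * ((a + t * Complex.I) * (q:ℂ)) ^ 3 - 0)) =
    2 * a * (a * q - 3 * a * (a ^ 2 - t ^ 2) * q ^ 2
      + 2 * a ^ 2 * (a ^ 3 - 3 * a * t ^ 2) * q ^ 3) := by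
  have : (2 * a : ℂ) * ((a + t * Complex.I) * (q : ℂ)
      - 3 * a * ((a + t * Complex.I) * (q:ℂ)) ^ 2
       + 2 * a ^ 2 * ((a + t * Complex.I) * (q:ℂ)) ^ 3 - 0) =
    ((2 * a * (a * q - 3 * a * (a ^ 2 - t ^ 2) * q ^ 2
      + 2 * a ^ 2 * (a ^ 3 - 3 * a * t ^ 2) * q ^ 3) : ℝ) : ℂ) +
    ((2 * a * (t * q - 3 * a * (2 * a * t) * q ^ 2
      + 2 * a ^ 2 * (3 * a ^ 2 * t - t ^ 3) * q ^ 3) : ℝ) : ℂ) * Complex.I := by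
    push_cast
    have h3 : Complex.I ^ 3 = -Complex.I := Complex.I_pow_three
    ring_nf
    rw [h3, Complex.I_sq]
    ring
  rw [this, RCLike.re_to_complex, Complex.add_re, Complex.re_ofReal_mul, Complex.I_re, Complex.ofReal_re, mul_zero, add_zero]

lemma auxF_integral (t : ℝ) {a : ℝ} (ha : 0 < a) :
    IntegrableOn (auxF t a) (Set.Ioi 0) ∧
    ∫ x in Set.Ioi (0:ℝ), auxF t a x =
      -(8 * t ^ 2 * a ^ 2 * (a ^ 2 - t ^ 2) / (a ^ 2 + t ^ 2) ^ 3) := by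
  obtain ⟨h1, e1⟩ := aux_complex (t := t) ha
  obtain ⟨h0, e0⟩ := aux_complex (t := 0) ha
  have hd : Integrable (fun x : ℝ => (2 * a : ℂ) *
      ((1 - 3 * a * x + a ^ 2 * x ^ 2 : ℂ) * Complex.exp (-((a - t * Complex.I) * x)) -
      (1 - 3 * a * x + a ^ 2 * x ^ 2 : ℂ) * Complex.exp (-((a - (0:ℝ) * Complex.I) * x))))
      (volume.restrict (Set.Ioi 0)) := (h1.sub h0).const_mul (2 * a : ℂ)
  have hre : ∀ x : ℝ, auxF t a x = RCLike.re ((2 * a : ℂ) *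
      ((1 - 3 * a * x + a ^ 2 * x ^ 2 : ℂ) * Complex.exp (-((a - t * Complex.I) * x)) -
      (1 - 3 * a * x + a ^ 2 * x ^ 2 : ℂ) * Complex.exp (-((a - (0:ℝ) * Complex.I) * x)))) := by
    intro x
    have : (-((a - t * Complex.I) * x) : ℂ) = ((-(a * x) : ℝ) : ℂ) + ((t * x : ℝ) : ℂ) * Complex.I := by
      push_cast; ring
    rw [this, Complex.exp_add, Complex.exp_mul_I, ← Complex.ofReal_exp, ← Complex.ofReal_cos,
      ← Complex.ofReal_sin]
    have : (-((a - (0:ℝ) * Complex.I) * x) : ℂ) = ((-(a * x) : ℝ) : ℂ) := by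
      push_cast; ring
    rw [this, ← Complex.ofReal_exp]
    have : (1 - 3 * a * x + a ^ 2 * x ^ 2 : ℂ) = ((1 - 3 * a * x + a ^ 2 * x ^ 2 : ℝ) : ℂ) := by
      push_cast; ring
    rw [this]
    simp only [RCLike.re_to_complex, auxF]
    generalize Real.exp (-(a * x)) = E
    generalize Real.cos (t * x) = C
    generalize Real.sin (t * x) = S
    generalize (1 - 3 * a * x + a ^ 2 * x ^ 2) = P
    simp
    ring
  have hfun : auxF t a = _ := funext hre
  constructor
  · rw [hfun]; exact hd.re
  · simp only [hre]
    rw [integral_re hd, integral_const_mul]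
    rw [integral_sub h1 h0, e1, e0]
    have hp : a ^ 2 + t ^ 2 ≠ 0 := by positivity
    have hinv : (1 / (a - t * Complex.I) : ℂ) = (a + t * Complex.I) * ((1 / (a ^ 2 + t ^ 2) : ℝ) : ℂ) := by
      have hz0 : (a - t * Complex.I : ℂ) ≠ 0 := by
        intro h; have := congrArg Complex.re h; simp at this; linarith
      have hp' : (a ^ 2 + t ^ 2 : ℂ) ≠ 0 := by exact_mod_cast hp
      push_cast
      field_simp
      linear_combination (t:ℂ)^2 * Complex.I_sq
    have hz : (1 / (a - t * Complex.I) - 3 * a / (a - t * Complex.I) ^ 2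
        + 2 * a ^ 2 / (a - t * Complex.I) ^ 3 : ℂ) = (1 / (a - t * Complex.I)) 
          - 3 * a * (1 / (a - t * Complex.I)) ^ 2 + 2 * a ^ 2 * (1 / (a - t * Complex.I)) ^ 3 := by
      generalize (a - t * Complex.I : ℂ) = z
      ring
    have hw : (1 / (a - (0:ℝ) * Complex.I) - 3 * a / (a - (0:ℝ) * Complex.I) ^ 2
        + 2 * a ^ 2 / (a - (0:ℝ) * Complex.I) ^ 3 : ℂ) = 0 := by
      have : (a : ℂ) ≠ 0 := by exact_mod_cast ha.ne'
      simp
      field_simp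
      ring
    rw [hw, hz, hinv]
    set q := 1 / (a ^ 2 + t ^ 2) with hq
    have := aux_re a t q
    rw [this, hq]
    field_simp
    ring

lemma auxF_norm (t : ℝ) {a : ℝ} (ha : 0 < a) :
    ∫ x in Set.Ioi (0:ℝ), ‖auxF t a x‖ ≤ 44 * t ^ 2 / a ^ 2 := by
  have m2 := aux_moment 2 ha
  have m3 := aux_moment 3 ha
  have m4 := aux_moment 4 ha
  have I := ((m2.1.const_mul (t ^ 2 * a)).add (m3.1.const_mul (3 * t ^ 2 * a ^ 2))).add
    (m4.1.const_mul (t ^ 2 * a ^ 3))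
  have E : ∫ x in Set.Ioi (0:ℝ), (t ^ 2 * a * (x ^ 2 * Real.exp (-(a * x))) +
      3 * t ^ 2 * a ^ 2 * (x ^ 3 * Real.exp (-(a * x))) +
      t ^ 2 * a ^ 3 * (x ^ 4 * Real.exp (-(a * x)))) = 44 * t ^ 2 / a ^ 2 := by
    have I2 : Integrable (fun x : ℝ => t ^ 2 * a * (x ^ 2 * Real.exp (-(a * x))) +
      3 * t ^ 2 * a ^ 2 * (x ^ 3 * Real.exp (-(a * x)))) (volume.restrict (Set.Ioi 0)) :=
      (m2.1.const_mul _).add (m3.1.const_mul _)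
    rw [integral_add I2 (m4.1.const_mul _),
      integral_add (m2.1.const_mul _) (m3.1.const_mul _), integral_const_mul, integral_const_mul,
      integral_const_mul, m2.2, m3.2, m4.2]
    simp [Nat.factorial]
    field_simp
    ring
  rw [← E]
  refine setIntegral_mono_on (auxF_integral t ha).1.norm I measurableSet_Ioi fun x hx => ?_
  have hx : 0 < x := hx
  have hc : |Real.cos (t * x) - 1| ≤ (t * x) ^ 2 / 2 := by
    rw [abs_le]
    constructor
    · linarith [Real.one_sub_sq_div_two_le_cos (x := t * x)]
    · nlinarith [Real.cos_le_one (t * x), sq_nonneg (t * x)]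
  have hq : |1 - 3 * a * x + a ^ 2 * x ^ 2| ≤ 1 + 3 * a * x + a ^ 2 * x ^ 2 := by
    have := mul_pos ha hx
    rw [abs_le]
    constructor <;> nlinarith [sq_nonneg (a * x)]
  rw [auxF, Real.norm_eq_abs, abs_mul, abs_mul, abs_mul, abs_of_pos (Real.exp_pos _),
    abs_of_pos (by positivity : 0 < 2 * a)]
  calc _ ≤ (t * x) ^ 2 / 2 * (2 * a * (1 + 3 * a * x + a ^ 2 * x ^ 2) * Real.exp (-(a * x))) := by
        gcongr
    _ = _ := by ring

lemma aux_summable : Summable (fun n : ℕ => 1 / (((n:ℝ) + 1) * π) ^ 2) := by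
  have h := (summable_nat_add_iff 1).2 (Real.summable_one_div_nat_pow.2 (one_lt_two))
  refine (h.mul_right (1 / π ^ 2)).congr fun n => ?_
  push_cast
  field_simp

lemma aux_series {x : ℝ} (hx : 0 < x) :
    HasSum (fun n : ℕ => 2 * (((n:ℝ) + 1) * π) * (1 - 3 * (((n:ℝ) + 1) * π) * x +
      (((n:ℝ) + 1) * π) ^ 2 * x ^ 2) * Real.exp (-((((n:ℝ) + 1) * π) * x)))
    ((π / 4) * (1 / Real.sinh (π * x / 2)) ^ 2 *
        (2 * π ^ 2 * x ^ 2 * (Real.cosh (π * x / 2) / Real.sinh (π * x / 2)) ^ 2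
          + π ^ 2 * x ^ 2 * (1 / Real.sinh (π * x / 2)) ^ 2
          - 6 * π * x * (Real.cosh (π * x / 2) / Real.sinh (π * x / 2)) + 2)) := by
  set p := Real.exp (-(π * x / 2)) with hp
  have hp0 : 0 < p := Real.exp_pos _
  have hp1 : p < 1 := by
    rw [hp, Real.exp_lt_one_iff]; have := mul_pos Real.pi_pos hx; linarith
  have hq1 : p ^ 2 < 1 := by nlinarith
  have hs : Real.sinh (π * x / 2) = (1 - p ^ 2) / (2 * p) := by
    rw [Real.sinh_eq, ← neg_neg (π * x / 2), Real.exp_neg (-(π * x / 2)), neg_neg, ← hp]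
    field_simp
  have hc : Real.cosh (π * x / 2) = (1 + p ^ 2) / (2 * p) := by
    rw [Real.cosh_eq, ← neg_neg (π * x / 2), Real.exp_neg (-(π * x / 2)), neg_neg, ← hp]
    field_simp
  have hn : ‖p ^ 2‖ < 1 := by rw [Real.norm_of_nonneg (by positivity)]; exact hq1
  have s1 := hasSum_choose_mul_geometric_of_norm_lt_one 1 hn
  have s2 := hasSum_choose_mul_geometric_of_norm_lt_one 2 hn
  have s3 := hasSum_choose_mul_geometric_of_norm_lt_one 3 hn
  have hne : 1 - p ^ 2 ≠ 0 := by linarith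
  have S := ((s1.mul_left (p ^ 2 * (2 * π + 6 * π ^ 2 * x + 2 * π ^ 3 * x ^ 2))).add
    (s2.mul_left (p ^ 2 * (-12 * π ^ 2 * x - 12 * π ^ 3 * x ^ 2)))).add
    (s3.mul_left (p ^ 2 * (12 * π ^ 3 * x ^ 2)))
  convert! S using 1
  · funext n
    have he : Real.exp (-((((n:ℝ) + 1) * π) * x)) = p ^ 2 * (p ^ 2) ^ n := by
      rw [← pow_succ', ← pow_mul, hp, ← Real.exp_nat_mul]
      congr 1
      push_cast; ring
    have c2 : (((n + 2).choose 2 : ℕ) : ℝ) = ((n:ℝ) + 1) * (n + 2) / 2 := by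
      rw [Nat.cast_choose_two]; push_cast; ring
    have c3 : (((n + 3).choose 3 : ℕ) : ℝ) = ((n:ℝ) + 1) * (n + 2) * (n + 3) / 6 := by
      have := Nat.add_one_mul_choose_eq (n + 2) 2
      have h : ((n:ℝ) + 2 + 1) * (((n + 2).choose 2 : ℕ) : ℝ) = (((n + 3).choose 3 : ℕ) : ℝ) * 3 := by
        exact_mod_cast this
      rw [c2] at h
      linarith
    rw [he, c2, c3, Nat.choose_one_right]
    push_cast
    ring
  · rw [hs, hc]
    field_simp
    ring

lemma aux_coth {t : ℝ} (ht : t ≠ 0) :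
    HasSum (fun n : ℕ => 2 * t ^ 2 / ((((n:ℝ) + 1) * π) ^ 2 + t ^ 2))
      (t * (Real.cosh t / Real.sinh t) - 1) := by
  have hpi : (π : ℂ) ≠ 0 := by exact_mod_cast Real.pi_ne_zero
  have htC : (t : ℂ) ≠ 0 := by exact_mod_cast ht
  set x : ℂ := t * Complex.I / π with hx
  have hx0 : x ≠ 0 := by
    rw [hx]; exact div_ne_zero (mul_ne_zero htC Complex.I_ne_zero) hpi
  have hxim : x.im = t / π := by
    rw [hx, Complex.div_ofReal_im]; simp
  have hz : x ∈ Complex.integerComplement := by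
    rintro ⟨n, hn⟩
    have := congrArg Complex.im hn
    rw [hxim] at this
    rw [Complex.intCast_im] at this
    exact div_ne_zero ht Real.pi_ne_zero this.symm
  have hsum := (summable_cotTerm hz).hasSum
  rw [← cot_series_rep' hz] at hsum
  have h2 := hsum.mul_left x
  rw [← Complex.hasSum_ofReal]
  convert! h2 using 1
  · funext n
    rw [cotTerm_identity hz]
    have h1 : (x + (n + 1)) * (x - (n + 1)) = -((((n:ℂ) + 1) * π) ^ 2 + t ^ 2) / π ^ 2 := by
      rw [hx]
      field_simp
      linear_combination (t:ℂ) ^ 2 * Complex.I_sq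
    have h2 : (((((n:ℝ) + 1) * π) ^ 2 + t ^ 2 : ℝ) : ℂ) ≠ 0 := by
      rw [Complex.ofReal_ne_zero]; positivity
    push_cast at h2
    rw [h1]
    have h3 : x * x = - t ^ 2 / π ^ 2 := by
      rw [hx]
      field_simp
      exact Complex.I_sq
    rw [show x * (2 * x * (1 / (-((((n:ℂ) + 1) * π) ^ 2 + t ^ 2) / π ^ 2))) =
      2 * (x * x) * (1 / (-((((n:ℂ) + 1) * π) ^ 2 + t ^ 2) / π ^ 2)) by ring, h3]
    push_cast
    generalize ((((n:ℂ) + 1) * π) ^ 2 + t ^ 2) = D at *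
    field_simp
  · have hs : Real.sinh t ≠ 0 := by rwa [Ne, Real.sinh_eq_zero]
    have hsC : Complex.sinh t ≠ 0 := by rw [← Complex.ofReal_sinh]; exact_mod_cast hs
    have e : (π : ℂ) * x = t * Complex.I := by rw [hx]; field_simp
    rw [mul_sub, mul_one_div_cancel hx0, ← mul_assoc, mul_comm x, e, Complex.cot,
      Complex.cos_mul_I, Complex.sin_mul_I]
    push_cast
    field_simp

lemma aux_deriv1 (t : ℝ) : HasDerivAt
    (fun s : ℝ => ∑' n : ℕ, 2 * s ^ 2 / ((((n:ℝ) + 1) * π) ^ 2 + s ^ 2))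
    (∑' n : ℕ, 4 * t * (((n:ℝ) + 1) * π) ^ 2 / ((((n:ℝ) + 1) * π) ^ 2 + t ^ 2) ^ 2) t := by
  refine hasDerivAt_tsum_of_isPreconnected
    (g' := fun (n : ℕ) t => 4 * t * (((n:ℝ) + 1) * π) ^ 2 / ((((n:ℝ) + 1) * π) ^ 2 + t ^ 2) ^ 2)
    (t := Set.Ioo (-(|t| + 1)) (|t| + 1)) (y₀ := 0)
    (aux_summable.mul_left (4 * (|t| + 1))) isOpen_Ioo isPreconnected_Ioo ?_ ?_ ?_ ?_ ?_
  · intro n y _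
    have hD : (((n:ℝ) + 1) * π) ^ 2 + y ^ 2 ≠ 0 := by positivity
    have h := (((hasDerivAt_id y).pow 2).const_mul 2).div
      (((hasDerivAt_id y).pow 2).const_add ((((n:ℝ) + 1) * π) ^ 2)) hD
    refine h.congr_deriv ?_
    simp
    field_simp
    ring
  · intro n y hy
    have ha : 0 < ((n:ℝ) + 1) * π := by positivity
    set a := ((n:ℝ) + 1) * π
    have hy' : |y| ≤ |t| + 1 := (abs_lt.2 hy).le
    rw [Real.norm_eq_abs, abs_div, abs_mul, abs_mul, abs_of_pos (by positivity : 0 < a ^ 2),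
      abs_of_pos (by positivity : 0 < (a ^ 2 + y ^ 2) ^ 2), abs_of_pos (by norm_num : (0:ℝ) < 4)]
    calc 4 * |y| * a ^ 2 / (a ^ 2 + y ^ 2) ^ 2 ≤ 4 * (|t| + 1) * a ^ 2 / (a ^ 2) ^ 2 := by
          gcongr
          nlinarith [sq_nonneg y]
      _ = _ := by field_simp
  · constructor <;> linarith [abs_nonneg t]
  · simp
  · constructor <;> linarith [le_abs_self t, neg_abs_le t]

lemma aux_deriv2 (t : ℝ) : HasDerivAt
    (fun s : ℝ => ∑' n : ℕ, 4 * s * (((n:ℝ) + 1) * π) ^ 2 / ((((n:ℝ) + 1) * π) ^ 2 + s ^ 2) ^ 2)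
    (∑' n : ℕ, 4 * (((n:ℝ) + 1) * π) ^ 2 * ((((n:ℝ) + 1) * π) ^ 2 - 3 * t ^ 2)
      / ((((n:ℝ) + 1) * π) ^ 2 + t ^ 2) ^ 3) t ∧
    Summable (fun n : ℕ => 4 * t * (((n:ℝ) + 1) * π) ^ 2 / ((((n:ℝ) + 1) * π) ^ 2 + t ^ 2) ^ 2) ∧
    Summable (fun n : ℕ => 4 * (((n:ℝ) + 1) * π) ^ 2 * ((((n:ℝ) + 1) * π) ^ 2 - 3 * t ^ 2)
      / ((((n:ℝ) + 1) * π) ^ 2 + t ^ 2) ^ 3) := by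
  have hb : ∀ (n : ℕ) (y : ℝ), ‖4 * (((n:ℝ) + 1) * π) ^ 2 * ((((n:ℝ) + 1) * π) ^ 2 - 3 * y ^ 2)
      / ((((n:ℝ) + 1) * π) ^ 2 + y ^ 2) ^ 3‖ ≤ 12 * (1 / (((n:ℝ) + 1) * π) ^ 2) := by
    intro n y
    have ha : 0 < ((n:ℝ) + 1) * π := by positivity
    set a := ((n:ℝ) + 1) * π
    have h1 : |a ^ 2 - 3 * y ^ 2| ≤ 3 * (a ^ 2 + y ^ 2) := by
      rw [abs_le]; constructor <;> nlinarith [sq_nonneg y, sq_nonneg a]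
    rw [Real.norm_eq_abs, abs_div, abs_mul, abs_of_pos (by positivity : 0 < 4 * a ^ 2),
      abs_of_pos (by positivity : 0 < (a ^ 2 + y ^ 2) ^ 3)]
    calc _ ≤ 4 * a ^ 2 * (3 * (a ^ 2 + y ^ 2)) / (a ^ 2 + y ^ 2) ^ 3 := by gcongr
      _ = 12 * a ^ 2 / (a ^ 2 + y ^ 2) ^ 2 := by field_simp; ring
      _ ≤ 12 * a ^ 2 / (a ^ 2) ^ 2 := by
          gcongr
          nlinarith [sq_nonneg y]
      _ = _ := by field_simp
  have hd : ∀ (n : ℕ) (y : ℝ), HasDerivAt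
      (fun s : ℝ => 4 * s * (((n:ℝ) + 1) * π) ^ 2 / ((((n:ℝ) + 1) * π) ^ 2 + s ^ 2) ^ 2)
      (4 * (((n:ℝ) + 1) * π) ^ 2 * ((((n:ℝ) + 1) * π) ^ 2 - 3 * y ^ 2)
      / ((((n:ℝ) + 1) * π) ^ 2 + y ^ 2) ^ 3) y := by
    intro n y
    have hD : ((((n:ℝ) + 1) * π) ^ 2 + y ^ 2) ^ 2 ≠ 0 := by positivity
    have hD1 : ((((n:ℝ) + 1) * π) ^ 2 + y ^ 2) ≠ 0 := by positivity
    have h := (((hasDerivAt_id y).const_mul 4).mul_const ((((n:ℝ) + 1) * π) ^ 2)).div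
      ((((hasDerivAt_id y).pow 2).const_add ((((n:ℝ) + 1) * π) ^ 2)).pow 2) hD
    refine h.congr_deriv ?_
    simp
    generalize ((n:ℝ) + 1) * π = a at *
    field_simp
    ring
  have hs0 : Summable (fun n : ℕ => 4 * (0:ℝ) * (((n:ℝ) + 1) * π) ^ 2 / ((((n:ℝ) + 1) * π) ^ 2 + 0 ^ 2) ^ 2) := by
    simp
  have hu := aux_summable.mul_left 12
  exact ⟨hasDerivAt_tsum hu hd hb hs0 t, summable_of_summable_hasDerivAt hu hd hb hs0 t,
    Summable.of_norm_bounded hu fun n => hb n t⟩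

lemma aux_total {t : ℝ} (ht : t ≠ 0) :
    ∑' n : ℕ, -(8 * t ^ 2 * (((n:ℝ) + 1) * π) ^ 2 * ((((n:ℝ) + 1) * π) ^ 2 - t ^ 2) /
      ((((n:ℝ) + 1) * π) ^ 2 + t ^ 2) ^ 3) =
    3 * t ^ 2 * (1 / Real.sinh t) ^ 2
          - t * (Real.cosh t / Real.sinh t) * (2 * t ^ 2 * (1 / Real.sinh t) ^ 2 + 1) := by
  have hnear : ∀ {s : ℝ}, s ≠ 0 → ∀ᶠ y in nhds s, y ≠ (0:ℝ) := fun hs => eventually_ne_nhds hs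
  have hsinh : ∀ {s : ℝ}, s ≠ 0 → Real.sinh s ≠ 0 := fun hs => by rwa [Ne, Real.sinh_eq_zero]
  have hv : ∀ {s : ℝ}, s ≠ 0 →
      ∑' n : ℕ, 4 * s * (((n:ℝ) + 1) * π) ^ 2 / ((((n:ℝ) + 1) * π) ^ 2 + s ^ 2) ^ 2 =
      Real.cosh s / Real.sinh s - s / Real.sinh s ^ 2 := by
    intro s hs
    have hS := hsinh hs
    have d1 := aux_deriv1 s
    have d2 : HasDerivAt (fun s : ℝ => s * (Real.cosh s / Real.sinh s) - 1)
        (Real.cosh s / Real.sinh s - s / Real.sinh s ^ 2) s := by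
      have h := ((hasDerivAt_id s).mul ((Real.hasDerivAt_cosh s).div (Real.hasDerivAt_sinh s) hS)).sub_const 1
      refine h.congr_deriv ?_
      have := Real.cosh_sq s
      simp
      field_simp
      rw [this]; ring
    refine d1.unique (d2.congr_of_eventuallyEq ?_)
    filter_upwards [hnear hs] with y hy
    exact (aux_coth hy).tsum_eq
  have hS := hsinh ht
  obtain ⟨d1, s1, s2⟩ := aux_deriv2 t
  have d2 : HasDerivAt (fun s : ℝ => Real.cosh s / Real.sinh s - s / Real.sinh s ^ 2)
      (-2 / Real.sinh t ^ 2 + 2 * t * Real.cosh t / Real.sinh t ^ 3) t := by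
    have h := ((Real.hasDerivAt_cosh t).div (Real.hasDerivAt_sinh t) hS).sub
      ((hasDerivAt_id t).div ((Real.hasDerivAt_sinh t).pow 2) (pow_ne_zero 2 hS))
    refine h.congr_deriv ?_
    have := Real.cosh_sq t
    simp
    field_simp
    rw [this]; ring
  have hw := d1.unique (d2.congr_of_eventuallyEq (by
    filter_upwards [hnear ht] with y hy
    exact hv hy))
  have key : ∑' n : ℕ, -(8 * t ^ 2 * (((n:ℝ) + 1) * π) ^ 2 * ((((n:ℝ) + 1) * π) ^ 2 - t ^ 2) /
      ((((n:ℝ) + 1) * π) ^ 2 + t ^ 2) ^ 3) =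
      (-t) * (Real.cosh t / Real.sinh t - t / Real.sinh t ^ 2) +
      (-t ^ 2) * (-2 / Real.sinh t ^ 2 + 2 * t * Real.cosh t / Real.sinh t ^ 3) := by
    rw [← hv ht, ← hw, ← tsum_mul_left, ← tsum_mul_left,
      ← (s1.mul_left (-t)).tsum_add (s2.mul_left (-t ^ 2))]
    congr 1
    funext n
    have hD : (((n:ℝ) + 1) * π) ^ 2 + t ^ 2 ≠ 0 := by positivity
    generalize ((n:ℝ) + 1) * π = a at *
    field_simp
    ring
  rw [key]
  field_simp
  ring

theorem stmt_2 (t : ℝ) :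
    ∫ x in Set.Ioi (0:ℝ),
      (Real.cos (t * x) - 1) * (π / 4) * (1 / Real.sinh (π * x / 2)) ^ 2 *
        (2 * π ^ 2 * x ^ 2 * (Real.cosh (π * x / 2) / Real.sinh (π * x / 2)) ^ 2
          + π ^ 2 * x ^ 2 * (1 / Real.sinh (π * x / 2)) ^ 2
          - 6 * π * x * (Real.cosh (π * x / 2) / Real.sinh (π * x / 2)) + 2)
    = if t = 0 then 0 else
        3 * t ^ 2 * (1 / Real.sinh t) ^ 2
          - t * (Real.cosh t / Real.sinh t) * (2 * t ^ 2 * (1 / Real.sinh t) ^ 2 + 1) := by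
  split_ifs with ht
  · subst ht
    simp
  have hpos : ∀ n : ℕ, 0 < ((n:ℝ) + 1) * π := fun n => by positivity
  have H := hasSum_integral_of_summable_integral_norm (μ := volume.restrict (Set.Ioi (0:ℝ)))
    (F := fun (n : ℕ) x => auxF t (((n:ℝ) + 1) * π) x)
    (fun n => (auxF_integral t (hpos n)).1)
    (Summable.of_nonneg_of_le (fun n => integral_nonneg fun x => norm_nonneg _)
      (fun n => auxF_norm t (hpos n))
      ((aux_summable.mul_left (44 * t ^ 2)).congr fun n => by ring))
  rw [← aux_total ht]
  have H2 := H.tsum_eq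
  simp only [(auxF_integral t (hpos _)).2] at H2
  rw [H2]
  refine setIntegral_congr_fun measurableSet_Ioi fun x hx => ?_
  have h := ((aux_series hx).mul_left (Real.cos (t * x) - 1)).tsum_eq
  simp only [auxF]
  rw [h]
  ring
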